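/- Suppose p ∈ (2,3]. Then for every z ≥ 1 and every x ≥ z one has ψ(z,x) ≤ 0. -/

import Mathlib

/-- `f(t) = t²/2 - tᵖ/p`. -/
noncomputable def f (p t : ℝ) : ℝ := t ^ 2 / 2 - t ^ p / p

/-- First derivative: `f'(t) = t - t^(p-1)`. -/
noncomputable def f' (p t : ℝ) : ℝ := t - t ^ (p - 1)

/-- Second derivative: `f''(t) = 1 - (p-1) t^(p-2)`. -/
noncomputable def f'' (p t : ℝ) : ℝ := 1 - (p - 1) * t ^ (p - 2)

/-- `ψ(z,x) = -f'(x)² - 3 f'(z) (f'(x) + (z-x) f''(x))`. -/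
noncomputable def ψ (p z x : ℝ) : ℝ :=
  -(f' p x) ^ 2 - 3 * f' p z * (f' p x + (z - x) * f'' p x)

/-- A power function with exponent in `[0, 1]` lies below its tangent lines. -/
lemma rpow_le_tangent {r x z : ℝ} (hr0 : 0 ≤ r) (hr1 : r ≤ 1) (hx : 0 < x) (hz : 0 ≤ z) :
    z ^ r ≤ x ^ r + r * x ^ (r - 1) * (z - x) := by
  have hzx : 0 ≤ z / x := by positivity
  have h := rpow_one_add_le_one_add_mul_self (s := z / x - 1) (by linarith) hr0 hr1
  rw [add_sub_cancel, Real.div_rpow hz hx.le, div_le_iff₀ (by positivity)] at h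
  calc z ^ r ≤ (1 + r * (z / x - 1)) * x ^ r := h
    _ = x ^ r + r * x ^ (r - 1) * (z - x) := by
      rw [Real.rpow_sub_one hx.ne']
      field_simp

/-- Trapezoid estimate for the integral of the concave function `t ↦ (r + 1) t ^ r`. -/
lemma trapezoid_le_rpow_sub_rpow {r x z : ℝ} (hr0 : 0 ≤ r) (hr1 : r ≤ 1) (hz : 0 < z)
    (hx : z ≤ x) :
    (x - z) * (r + 1) * (x ^ r + z ^ r) / 2 ≤ x ^ (r + 1) - z ^ (r + 1) := by
  let g : ℝ → ℝ := fun t ↦ t ^ (r + 1) - (t - z) * ((r + 1) * (t ^ r + z ^ r) / 2)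
  have hg : ∀ t, z ≤ t → HasDerivAt g
      ((r + 1) / 2 * (t ^ r - z ^ r + r * t ^ (r - 1) * (z - t))) t := by
    intro t ht
    have ht0 : t ≠ 0 := (hz.trans_le ht).ne'
    have h1 := Real.hasDerivAt_rpow_const (p := r + 1) (Or.inl ht0)
    have h2 := Real.hasDerivAt_rpow_const (p := r) (Or.inl ht0)
    have h3 := h1.sub (((hasDerivAt_id t).sub_const z).mul
      (((h2.add_const (z ^ r)).const_mul (r + 1)).div_const 2))
    refine HasDerivAt.congr_deriv (f := g) h3 ?_
    simp only [id, add_sub_cancel_right]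
    ring
  have hmono : MonotoneOn g (Set.Ici z) := by
    refine monotoneOn_of_hasDerivWithinAt_nonneg (convex_Ici z)
      (fun t ht ↦ (hg t ht).continuousAt.continuousWithinAt)
      (fun t ht ↦ (hg t (interior_subset ht)).hasDerivWithinAt) fun t ht ↦ ?_
    have ht' : z ≤ t := interior_subset ht
    have h := rpow_le_tangent hr0 hr1 (hz.trans_le ht') hz.le
    exact mul_nonneg (by linarith) (by linarith)
  have h : g z ≤ g x := hmono Set.self_mem_Ici hx hx
  simp only [g, sub_self, zero_mul, sub_zero] at h
  linarith

lemma f'_nonpos {p t : ℝ} (hp : 2 ≤ p) (ht : 1 ≤ t) : f' p t ≤ 0 :=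
  sub_nonpos.2 (Real.self_le_rpow_of_one_le ht (by linarith))

lemma f''_nonpos {p t : ℝ} (hp : 2 ≤ p) (ht : 1 ≤ t) : f'' p t ≤ 0 := by
  have h : 1 ≤ t ^ (p - 2) := Real.one_le_rpow ht (by linarith)
  unfold f''
  nlinarith

lemma f'_le_trapezoid {p z x : ℝ} (hp : 2 ≤ p) (hp3 : p ≤ 3) (hz : 0 < z) (hx : z ≤ x) :
    f' p x ≤ f' p z + (x - z) * (f'' p z + f'' p x) / 2 := by
  have h := trapezoid_le_rpow_sub_rpow (r := p - 2) (by linarith) (by linarith) hz hx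
  rw [show p - 2 + 1 = p - 1 by ring] at h
  unfold f' f''
  linarith

/-- for `p ∈ (2,3]`, every `z ≥ 1` and every `x ≥ z`, `ψ(z,x) ≤ 0`. -/
theorem stmt_2 (p : ℝ) (hp : 2 < p) (hp3 : p ≤ 3) (z x : ℝ) (hz : 1 ≤ z) (hx : z ≤ x) :
    ψ p z x ≤ 0 := by
  have ha := f'_nonpos hp.le hz
  have hb := mul_nonpos_of_nonneg_of_nonpos (sub_nonneg.2 hx) (f''_nonpos hp.le hz)
  have hs := mul_nonpos_of_nonneg_of_nonpos (sub_nonneg.2 hx) (f''_nonpos hp.le (hz.trans hx))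
  have htrap := f'_le_trapezoid hp.le hp3 (by linarith) hx
  have hψ : ψ p z x = -(f' p x) ^ 2 - 3 * f' p z * (f' p x - (x - z) * f'' p x) := by
    unfold ψ
    ring
  rw [mul_add] at htrap
  rw [hψ]
  generalize f' p z = a at *
  generalize f' p x = y at *
  generalize (x - z) * f'' p z = b at *
  generalize (x - z) * f'' p x = s at *
  have hy : a + (b + s) / 2 ≤ 0 := by linarith
  have hsq : (a + (b + s) / 2) ^ 2 ≤ y ^ 2 := by nlinarith
  have hay : a * (a + (b + s) / 2) ≤ a * y := mul_le_mul_of_nonpos_left (by linarith) ha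
  nlinarith [mul_nonneg_of_nonpos_of_nonpos ha hb, mul_nonneg_of_nonpos_of_nonpos hb hs,
    sq_nonneg (s - a), sq_nonneg b, sq_nonneg a, sq_nonneg s]
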